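/- Let A be a randomized algorithm with oracle access to x ∈ {0,1}^n that uses r random bits and makes at most q queries, always accepts when x belongs to a set Y, and rejects with probability at least γ > 0 when x belongs to a disjoint set N. Then there exists a quantum algorithm making O(q/√γ) queries to the unitary oracle U_x : |i⟩|b⟩ ↦ |i⟩|b ⊕ x_i⟩ that always accepts when x ∈ Y and rejects with probability at least 2/3 when x ∈ N. -/

import Mathlib

open scoped Classical

/-- Decision trees querying bits of an `n`-bit string. -/
inductive DTree (n : ℕ) : Type
  | leaf : Bool → DTree n
  | node : Fin n → DTree n → DTree n → DTree n

/-- Depth of a decision tree. -/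
def DTree.depth {n : ℕ} : DTree n → ℕ
  | .leaf _ => 0
  | .node _ l r => max l.depth r.depth + 1

/-- Evaluation of a decision tree on an input `x ∈ {0,1}ⁿ`. -/
def DTree.eval {n : ℕ} : DTree n → (Fin n → Bool) → Bool
  | .leaf b, _ => b
  | .node i l r, x => if x i then l.eval x else r.eval x

/-- The quantum oracle `U_x : |i⟩|b⟩|w⟩ ↦ |i⟩|b ⊕ xᵢ⟩|w⟩` as a matrix on the
basis `Fin n × Bool × Fin m` (query register, answer qubit, workspace). -/
noncomputable def oracleMat (n m : ℕ) (x : Fin n → Bool) :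
    Matrix (Fin n × Bool × Fin m) (Fin n × Bool × Fin m) ℂ :=
  fun s t => if t = (s.1, xor s.2.1 (x s.1), s.2.2) then 1 else 0

/-- The unitary `V_q U_x V_{q-1} ⋯ U_x V_0` of a quantum query algorithm that
interleaves the unitaries `Vs` with `q` oracle calls. -/
noncomputable def chain (n m : ℕ) (x : Fin n → Bool)
    (Vs : ℕ → Matrix (Fin n × Bool × Fin m) (Fin n × Bool × Fin m) ℂ) :
    ℕ → Matrix (Fin n × Bool × Fin m) (Fin n × Bool × Fin m) ℂ
  | 0 => Vs 0
  | t + 1 => Vs (t + 1) * oracleMat n m x * chain n m x Vs t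

/-- Acceptance probability: the squared mass of the final state (started from
basis state `init`) on the accepting basis states `Acc`. -/
noncomputable def acceptProb (n m : ℕ) (x : Fin n → Bool)
    (Vs : ℕ → Matrix (Fin n × Bool × Fin m) (Fin n × Bool × Fin m) ℂ)
    (q : ℕ) (Acc : Finset (Fin n × Bool × Fin m))
    (init : Fin n × Bool × Fin m) : ℝ :=
  ∑ s ∈ Acc, Complex.normSq (chain n m x Vs q s init)

namespace AmpAmp

/-- Permutation matrix. -/
def permMat {B : Type*} [DecidableEq B] (σ : Equiv.Perm B) : Matrix B B ℂ :=
  fun s t => if t = σ s then 1 else 0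

section perm
variable {B : Type*} [DecidableEq B] [Fintype B]

lemma permMat_mul (σ τ : Equiv.Perm B) :
    permMat σ * permMat τ = permMat (σ.trans τ) := by
  ext s t
  simp only [permMat, Matrix.mul_apply, Equiv.trans_apply]
  rw [Finset.sum_eq_single (σ s)]
  · by_cases h : t = τ (σ s) <;> simp [h]
  · intro b _ hb; simp [hb]
  · simp

lemma permMat_one : permMat (Equiv.refl B) = 1 := by
  ext s t
  simp [permMat, Matrix.one_apply, eq_comm]

lemma permMat_star (σ : Equiv.Perm B) : star (permMat σ) = permMat σ.symm := by
  ext s t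
  simp [permMat, Matrix.star_apply, Equiv.eq_symm_apply, eq_comm, apply_ite]

lemma permMat_unitary (σ : Equiv.Perm B) : permMat σ ∈ Matrix.unitaryGroup B ℂ := by
  rw [Matrix.mem_unitaryGroup_iff, permMat_star, permMat_mul, Equiv.self_trans_symm, permMat_one]

lemma permMat_conj (σ : Equiv.Perm B) (d : B → ℂ) :
    permMat σ * Matrix.diagonal d * permMat σ.symm = Matrix.diagonal (fun s => d (σ s)) := by
  ext s t
  rw [Matrix.mul_apply]
  simp only [Matrix.mul_diagonal, permMat, Matrix.diagonal_apply]
  rw [Finset.sum_eq_single (σ s)]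
  · simp [eq_comm]
  · intro b _ hb; simp [hb]
  · simp

lemma exists_unitary (Φ : B → ℂ) (init : B) (h : ∑ s, Complex.normSq (Φ s) = 1) :
    ∃ V ∈ Matrix.unitaryGroup B ℂ, ∀ s, V s init = Φ s := by
  have ho : Orthonormal ℂ (({init} : Set B).domRestrict
      (fun _ : B => (WithLp.toLp 2 Φ : EuclideanSpace ℂ B))) := by
    rw [orthonormal_iff_ite]
    rintro ⟨i, hi⟩ ⟨j, hj⟩
    simp only [Set.mem_singleton_iff] at hi hj
    subst hi; subst hj
    simp only [Set.domRestrict_apply, inner_self_eq_norm_sq_to_K, EuclideanSpace.norm_eq, if_true]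
    have : ∑ i, ‖Φ i‖ ^ 2 = 1 := by
      rw [← h]; refine Finset.sum_congr rfl fun s _ => ?_
      rw [Complex.normSq_eq_norm_sq]
    simp [this]
  obtain ⟨b, hb⟩ := ho.exists_orthonormalBasis_extension_of_card_eq (by simp)
  refine ⟨(EuclideanSpace.basisFun B ℂ).toBasis.toMatrix b,
    OrthonormalBasis.toMatrix_orthonormalBasis_mem_unitary _ _, fun s => ?_⟩
  simp [Module.Basis.toMatrix_apply, hb init rfl]

end perm

/-- The oracle as a permutation. -/
def orcPerm {n : ℕ} (W : Type*) (x : Fin n → Bool) : Equiv.Perm (Fin n × Bool × W) :=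
  Function.Involutive.toPerm (fun s => (s.1, xor s.2.1 (x s.1), s.2.2)) (by
    rintro ⟨i, b, w⟩; simp)

lemma orcPerm_apply {n : ℕ} (W : Type*) (x : Fin n → Bool) (s : Fin n × Bool × W) :
    orcPerm W x s = (s.1, xor s.2.1 (x s.1), s.2.2) := rfl

/-- Implementable with a number of queries. -/
inductive Impl {n : ℕ} {W : Type} [Fintype W] [DecidableEq W] :
    ℕ → ((Fin n → Bool) → Matrix (Fin n × Bool × W) (Fin n × Bool × W) ℂ) → Prop
  | unit (V : Matrix (Fin n × Bool × W) (Fin n × Bool × W) ℂ)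
      (hV : V ∈ Matrix.unitaryGroup (Fin n × Bool × W) ℂ) : Impl 0 (fun _ => V)
  | orc : Impl 1 (fun x => permMat (orcPerm W x))
  | mul {a b F G} : Impl a F → Impl b G → Impl (a + b) (fun x => F x * G x)

lemma Impl.congr' {n : ℕ} {W : Type} [Fintype W] [DecidableEq W] {a b : ℕ}
    {F G : (Fin n → Bool) → Matrix (Fin n × Bool × W) (Fin n × Bool × W) ℂ}
    (h : Impl a F) (hab : a = b) (hFG : ∀ x, F x = G x) : Impl b G := by
  obtain rfl : F = G := funext hFG
  subst hab
  exact h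

lemma chain_mul (n m a b : ℕ) (x : Fin n → Bool)
    (P Q : ℕ → Matrix (Fin n × Bool × Fin m) (Fin n × Bool × Fin m) ℂ) :
    chain n m x (fun t => if t < b then Q t else if t = b then P 0 * Q b else P (t - b)) (b + a)
      = chain n m x P a * chain n m x Q b := by
  have hlt : ∀ c < b, chain n m x
      (fun t => if t < b then Q t else if t = b then P 0 * Q b else P (t - b)) c
      = chain n m x Q c := by
    intro c
    induction c with
    | zero => intro h; simp [chain, h]
    | succ c ih => intro h; simp only [chain]; rw [ih (by omega), if_pos h]
  induction a with
  | zero =>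
    cases b with
    | zero => simp [chain]
    | succ b =>
      simp only [chain, Nat.add_zero]
      rw [hlt b (by omega)]
      simp [Matrix.mul_assoc]
  | succ a ih =>
    rw [← Nat.add_assoc]
    simp only [chain]
    rw [ih, if_neg (by omega), if_neg (by omega)]
    rw [show b + a + 1 - b = a + 1 by omega]
    simp only [Matrix.mul_assoc]

/-- Basis equivalence. -/
def basisEquiv (n : ℕ) {W : Type} {m : ℕ} (e : W ≃ Fin m) :
    (Fin n × Bool × Fin m) ≃ (Fin n × Bool × W) :=
  (Equiv.refl _).prodCongr ((Equiv.refl _).prodCongr e.symm)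

lemma unitary_submatrix {A B : Type*} [Fintype A] [Fintype B] [DecidableEq A] [DecidableEq B]
    (e : A ≃ B) (V : Matrix B B ℂ) (hV : V ∈ Matrix.unitaryGroup B ℂ) :
    V.submatrix e e ∈ Matrix.unitaryGroup A ℂ := by
  rw [Matrix.mem_unitaryGroup_iff] at hV ⊢
  rw [Matrix.star_eq_conjTranspose] at hV ⊢
  rw [Matrix.conjTranspose_submatrix, Matrix.submatrix_mul_equiv, hV, Matrix.submatrix_one_equiv]

lemma Impl.toChain {n : ℕ} {W : Type} [Fintype W] [DecidableEq W] {m : ℕ} (e : W ≃ Fin m)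
    {k : ℕ} {F : (Fin n → Bool) → Matrix (Fin n × Bool × W) (Fin n × Bool × W) ℂ}
    (h : Impl k F) :
    ∃ Vs : ℕ → Matrix (Fin n × Bool × Fin m) (Fin n × Bool × Fin m) ℂ,
      (∀ t, Vs t ∈ Matrix.unitaryGroup (Fin n × Bool × Fin m) ℂ) ∧
      ∀ x, chain n m x Vs k = (F x).submatrix (basisEquiv n e) (basisEquiv n e) := by
  induction h with
  | unit V hV =>
    exact ⟨fun _ => V.submatrix (basisEquiv n e) (basisEquiv n e),
      fun _ => unitary_submatrix _ _ hV, fun x => rfl⟩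
  | orc =>
    refine ⟨fun _ => 1, fun _ => one_mem _, fun x => ?_⟩
    ext ⟨i, b, w⟩ ⟨i', b', w'⟩
    simp [chain, oracleMat, permMat, basisEquiv, orcPerm_apply]
  | @mul a b F G _ _ ih1 ih2 =>
    obtain ⟨P, hP, hP'⟩ := ih1
    obtain ⟨Q, hQ, hQ'⟩ := ih2
    refine ⟨fun t => if t < b then Q t else if t = b then P 0 * Q b else P (t - b), ?_, ?_⟩
    · intro t
      dsimp only
      split_ifs
      · exact hQ _
      · exact mul_mem (hP _) (hQ _)
      · exact hP _
    · intro x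
      rw [Nat.add_comm a b, chain_mul, hP', hQ', Matrix.submatrix_mul_equiv]

/-! ### Decision trees -/

/-- The child reached after an answer. -/
def child {n : ℕ} : DTree n → Bool → DTree n
  | .leaf b, _ => .leaf b
  | .node _ l r, b => if b then l else r

/-- The index queried next. -/
def idx {n : ℕ} (i0 : Fin n) : DTree n → Fin n
  | .leaf _ => i0
  | .node i _ _ => i

/-- The value at a leaf. -/
def leafVal {n : ℕ} : DTree n → Bool
  | .leaf b => b
  | .node _ _ _ => true

lemma eval_child {n : ℕ} (i0 : Fin n) (x : Fin n → Bool) (T : DTree n) :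
    (child T (x (idx i0 T))).eval x = T.eval x := by
  cases T with
  | leaf b => rfl
  | node i l r => 
    change (if x i then l else r).eval x = if x i then l.eval x else r.eval x
    split_ifs <;> rfl

lemma depth_child {n : ℕ} (T : DTree n) (b : Bool) : (child T b).depth ≤ T.depth - 1 := by
  cases T with
  | leaf b => simp [child, DTree.depth]
  | node i l r => cases b <;> simp [child, DTree.depth]

lemma leafVal_eq {n : ℕ} (T : DTree n) (h : T.depth = 0) (x : Fin n → Bool) :
    leafVal T = T.eval x := by
  cases T with
  | leaf b => rfl
  | node i l r => simp [DTree.depth] at h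

section circuit
variable {n r q M : ℕ}

/-- Slot of the history used at time `t`. -/
def slot (q t : ℕ) : Fin (q + 1) := ⟨min t q, by omega⟩

/-- Workspace. -/
abbrev Wk (r q M : ℕ) := (Fin r → Bool) × (Fin (q + 1) → Bool) × Fin M

/-- Full basis. -/
abbrev Bs (n r q M : ℕ) := Fin n × Bool × Wk r q M

noncomputable instance decWk (r q M : ℕ) : DecidableEq (Wk r q M) := Classical.decEq _

noncomputable instance decBs (n r q M : ℕ) : DecidableEq (Bs n r q M) :=
  @instDecidableEqProd (Fin n) (Bool × Wk r q M) _
    (@instDecidableEqProd Bool (Wk r q M) _ (decWk r q M))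

/-- The current subtree. -/
def cur (T : (Fin r → Bool) → DTree n) (ρ : Fin r → Bool) (h : Fin (q + 1) → Bool) : ℕ → DTree n
  | 0 => T ρ
  | t + 1 => child (cur T ρ h t) (h (slot q t))

lemma cur_update (T : (Fin r → Bool) → DTree n) (ρ : Fin r → Bool) (h : Fin (q + 1) → Bool)
    (s : ℕ) (hs : s ≤ q) (v : Bool) (t : ℕ) (ht : t ≤ s) :
    cur T ρ (Function.update h (slot q s) v) t = cur T ρ h t := by
  induction t with
  | zero => rfl
  | succ t ih =>
    simp only [cur]
    rw [ih (by omega), Function.update_of_ne]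
    simp only [slot, ne_eq, Fin.mk.injEq]
    omega

/-- Load the query index. -/
def loadPerm (i0 : Fin n) (T : (Fin r → Bool) → DTree n) (t : ℕ) : Equiv.Perm (Bs n r q M) :=
  Function.Involutive.toPerm
    (fun s => (Equiv.swap i0 (idx i0 (cur T s.2.2.1 s.2.2.2.1 t)) s.1, s.2)) (by
    rintro ⟨i, b, ρ, h, j⟩; simp)

/-- Swap the answer bit with a history slot. -/
def savePerm (t : ℕ) : Equiv.Perm (Bs n r q M) :=
  Function.Involutive.toPerm
    (fun s => (s.1, s.2.2.2.1 (slot q t), s.2.2.1,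
      Function.update s.2.2.2.1 (slot q t) s.2.1, s.2.2.2.2)) (by
    rintro ⟨i, b, ρ, h, j⟩; simp)

lemma loadPerm_apply (i0 : Fin n) (T : (Fin r → Bool) → DTree n) (t : ℕ) (s : Bs n r q M) :
    loadPerm i0 T t s = (Equiv.swap i0 (idx i0 (cur T s.2.2.1 s.2.2.2.1 t)) s.1, s.2) := rfl

lemma savePerm_apply (t : ℕ) (s : Bs n r q M) :
    savePerm t s = (s.1, s.2.2.2.1 (slot q t), s.2.2.1,
      Function.update s.2.2.2.1 (slot q t) s.2.1, s.2.2.2.2) := rfl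

/-- One classical step. -/
def stepPerm (i0 : Fin n) (T : (Fin r → Bool) → DTree n) (x : Fin n → Bool) (t : ℕ) :
    Equiv.Perm (Bs n r q M) :=
  (((loadPerm i0 T t).trans (orcPerm _ x)).trans (loadPerm i0 T t)).trans (savePerm t)

/-- The classical computation. -/
def compPerm (i0 : Fin n) (T : (Fin r → Bool) → DTree n) (x : Fin n → Bool) :
    ℕ → Equiv.Perm (Bs n r q M)
  | 0 => Equiv.refl _
  | t + 1 => (compPerm i0 T x t).trans (stepPerm i0 T x t)

lemma comp_spec (i0 : Fin n) (T : (Fin r → Bool) → DTree n) (hT : ∀ ρ, (T ρ).depth ≤ q)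
    (x : Fin n → Bool) (ρ : Fin r → Bool) (j : Fin M) (t : ℕ) (ht : t ≤ q) :
    ∃ h : Fin (q + 1) → Bool,
      compPerm (q := q) i0 T x t (i0, false, ρ, fun _ => false, j) = (i0, false, ρ, h, j) ∧
      (∀ s, t ≤ s → h (slot q s) = false) ∧
      (cur T ρ h t).eval x = (T ρ).eval x ∧ (cur T ρ h t).depth ≤ q - t := by
  induction t with
  | zero => exact ⟨fun _ => false, rfl, fun _ _ => rfl, rfl, hT ρ⟩
  | succ t ih =>
    obtain ⟨h, h1, h2, h3, h4⟩ := ih (by omega)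
    refine ⟨Function.update h (slot q t) (x (idx i0 (cur T ρ h t))), ?_, ?_, ?_, ?_⟩
    · simp only [compPerm, Equiv.trans_apply, h1]
      simp [stepPerm, loadPerm_apply, savePerm_apply, orcPerm_apply, h2 t le_rfl]
    · intro s hs
      rw [Function.update_of_ne, h2 s (by omega)]
      simp only [slot, ne_eq, Fin.mk.injEq]
      omega
    · simp only [cur]
      rw [cur_update _ _ _ _ (by omega) _ _ le_rfl, Function.update_self, eval_child, h3]
    · simp only [cur]
      refine (depth_child _ _).trans ?_
      rw [cur_update _ _ _ _ (by omega) _ _ le_rfl]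
      omega

lemma impl_step (i0 : Fin n) (T : (Fin r → Bool) → DTree n) (t : ℕ) :
    Impl 1 (fun x => permMat (stepPerm (q := q) (M := M) i0 T x t)) := by
  have := Impl.mul (Impl.mul (Impl.mul (Impl.unit _ (permMat_unitary
    (loadPerm (q := q) (M := M) i0 T t))) Impl.orc)
    (Impl.unit _ (permMat_unitary (loadPerm (q := q) (M := M) i0 T t))))
    (Impl.unit _ (permMat_unitary (savePerm (n := n) (r := r) (q := q) (M := M) t)))
  simp only [permMat_mul] at this
  exact this

lemma impl_step_symm (i0 : Fin n) (T : (Fin r → Bool) → DTree n) (t : ℕ) :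
    Impl 1 (fun x => permMat (stepPerm (q := q) (M := M) i0 T x t).symm) := by
  have := Impl.mul (Impl.unit _ (permMat_unitary
    (savePerm (n := n) (r := r) (q := q) (M := M) t)))
    (Impl.mul (Impl.unit _ (permMat_unitary
    (loadPerm (q := q) (M := M) i0 T t))) (Impl.mul Impl.orc
    (Impl.unit _ (permMat_unitary (loadPerm (q := q) (M := M) i0 T t)))))
  simp only [permMat_mul] at this
  exact this

lemma impl_comp (i0 : Fin n) (T : (Fin r → Bool) → DTree n) (t : ℕ) :
    Impl t (fun x => permMat (compPerm (q := q) (M := M) i0 T x t)) := by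
  induction t with
  | zero => exact Impl.unit (permMat (Equiv.refl (Bs n r q M))) (permMat_unitary _)
  | succ t ih =>
    have := Impl.mul ih (impl_step (q := q) (M := M) i0 T t)
    simp only [permMat_mul] at this
    exact this

lemma impl_comp_symm (i0 : Fin n) (T : (Fin r → Bool) → DTree n) (t : ℕ) :
    Impl t (fun x => permMat (compPerm (q := q) (M := M) i0 T x t).symm) := by
  induction t with
  | zero => exact Impl.unit (permMat (Equiv.refl (Bs n r q M))) (permMat_unitary _)
  | succ t ih =>
    have := Impl.mul (impl_step_symm (q := q) (M := M) i0 T t) ih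
    simp only [permMat_mul] at this
    exact this.congr' (Nat.add_comm _ _) (fun x => rfl)

/-- Controlled phase. -/
noncomputable def ph (T : (Fin r → Bool) → DTree n) (k : ℕ) (s : Bs n r q M) : ℂ :=
  if k < (s.2.2.2.2 : ℕ) then (if leafVal (cur T s.2.2.1 s.2.2.2.1 q) then 1 else -1) else 1

lemma ph_unitary (T : (Fin r → Bool) → DTree n) (k : ℕ) :
    Matrix.diagonal (ph (q := q) (M := M) T k) ∈ Matrix.unitaryGroup (Bs n r q M) ℂ := by
  rw [Matrix.mem_unitaryGroup_iff, Matrix.star_eq_conjTranspose, Matrix.diagonal_conjTranspose,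
    Matrix.diagonal_mul_diagonal, ← Matrix.diagonal_one]
  congr 1
  ext s
  simp only [ph, Pi.star_apply]
  split_ifs <;> simp

lemma impl_phase (i0 : Fin n) (T : (Fin r → Bool) → DTree n) (k : ℕ) :
    Impl (2 * q) (fun x => Matrix.diagonal
      (fun s => ph (q := q) (M := M) T k (compPerm i0 T x q s))) := by
  have := Impl.mul (Impl.mul (impl_comp (q := q) (M := M) i0 T q)
    (Impl.unit _ (ph_unitary T k))) (impl_comp_symm (q := q) (M := M) i0 T q)
  simp only [permMat_conj] at this
  exact this.congr' (by omega) (fun x => rfl)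

/-- Controlled averaging. -/
noncomputable def Jm (n r q M k : ℕ) : Matrix (Bs n r q M) (Bs n r q M) ℂ :=
  fun s t => if t.1 = s.1 ∧ t.2.1 = s.2.1 ∧ t.2.2.2 = s.2.2.2 ∧ k < (s.2.2.2.2 : ℕ)
    then (1 / 2 ^ r : ℂ) else 0

/-- Control projection. -/
noncomputable def Dm (n r q M k : ℕ) : Matrix (Bs n r q M) (Bs n r q M) ℂ :=
  Matrix.diagonal fun s => if k < (s.2.2.2.2 : ℕ) then 1 else 0

/-- Controlled reflection. -/
noncomputable def Rm (n r q M k : ℕ) : Matrix (Bs n r q M) (Bs n r q M) ℂ :=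
  1 - (2 : ℂ) • (Dm n r q M k - Jm n r q M k)

lemma Jm_mulVec (k : ℕ) (ψ : Bs n r q M → ℂ) (s : Bs n r q M) :
    (Jm n r q M k).mulVec ψ s = if k < (s.2.2.2.2 : ℕ) then
      (1 / 2 ^ r : ℂ) * ∑ ρ, ψ (s.1, s.2.1, ρ, s.2.2.2) else 0 := by
  obtain ⟨i, b, ρ, hj⟩ := s
  simp only [Matrix.mulVec, dotProduct, Jm]
  split_ifs with hk
  · simp only [hk, and_true]
    rw [Fintype.sum_prod_type, Finset.sum_eq_single i]
    · rw [Fintype.sum_prod_type, Finset.sum_eq_single b]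
      · rw [Fintype.sum_prod_type, Finset.mul_sum]
        refine Finset.sum_congr rfl fun ρ' _ => ?_
        rw [Finset.sum_eq_single hj]
        · simp
        · intro c _ hc; simp [hc]
        · simp
      · intro c _ hc; simp [hc]
      · simp
    · intro c _ hc; simp [hc]
    · simp
  · simp [hk]

lemma Jm_mul (k : ℕ) : Jm n r q M k * Jm n r q M k = Jm n r q M k := by
  ext s t
  have : (Jm n r q M k * Jm n r q M k) s t
      = (Jm n r q M k).mulVec (fun u => Jm n r q M k u t) s := rfl
  rw [this, Jm_mulVec]
  simp only [Jm]
  split_ifs with h1 h2 h2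
  · simp
  · simp
  · exact absurd h2.2.2.2 h1
  · rfl

lemma Dm_mul (k : ℕ) : Dm n r q M k * Dm n r q M k = Dm n r q M k := by
  simp [Dm, Matrix.diagonal_mul_diagonal]

lemma DJ_mul (k : ℕ) : Dm n r q M k * Jm n r q M k = Jm n r q M k := by
  ext s t
  simp only [Dm, Matrix.diagonal_mul, Jm]
  split_ifs <;> simp_all

lemma Dm_star (k : ℕ) : star (Dm n r q M k) = Dm n r q M k := by
  rw [Dm, Matrix.star_eq_conjTranspose, Matrix.diagonal_conjTranspose]
  congr 1
  ext s
  simp only [Pi.star_apply]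
  split_ifs <;> simp

lemma Jm_star (k : ℕ) : star (Jm n r q M k) = Jm n r q M k := by
  ext s t
  simp only [Matrix.star_apply, Jm]
  have : (s.1 = t.1 ∧ s.2.1 = t.2.1 ∧ s.2.2.2 = t.2.2.2 ∧ k < (t.2.2.2.2 : ℕ)) ↔
    (t.1 = s.1 ∧ t.2.1 = s.2.1 ∧ t.2.2.2 = s.2.2.2 ∧ k < (s.2.2.2.2 : ℕ)) := by
    constructor
    · rintro ⟨h1, h2, h3, h4⟩; rw [h3]; exact ⟨h1.symm, h2.symm, rfl, h4⟩
    · rintro ⟨h1, h2, h3, h4⟩; rw [h3]; exact ⟨h1.symm, h2.symm, rfl, h4⟩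
  simp only [this]
  split_ifs <;> simp

lemma JD_mul (k : ℕ) : Jm n r q M k * Dm n r q M k = Jm n r q M k := by
  have := congrArg star (DJ_mul (n := n) (r := r) (q := q) (M := M) k)
  rwa [star_mul, Dm_star, Jm_star] at this

lemma Rm_unitary (k : ℕ) : Rm n r q M k ∈ Matrix.unitaryGroup (Bs n r q M) ℂ := by
  have h1 : star (Rm n r q M k) = Rm n r q M k := by
    rw [Rm, star_sub, star_smul, star_sub, Dm_star, Jm_star, star_one]
    simp
  have h2 : (Dm n r q M k - Jm n r q M k) * (Dm n r q M k - Jm n r q M k)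
      = Dm n r q M k - Jm n r q M k := by
    simp only [sub_mul, mul_sub, Dm_mul, Jm_mul, DJ_mul, JD_mul, sub_self, sub_zero]
  rw [Matrix.mem_unitaryGroup_iff, h1, Rm]
  generalize Dm n r q M k - Jm n r q M k = E at h2
  rw [sub_mul, mul_sub, mul_sub, one_mul, mul_one, one_mul, smul_mul_assoc, mul_smul_comm, h2]
  module

/-- One round. -/
noncomputable def rnd (i0 : Fin n) (T : (Fin r → Bool) → DTree n) (k : ℕ) (x : Fin n → Bool) :
    Matrix (Bs n r q M) (Bs n r q M) ℂ :=
  Rm n r q M k * Matrix.diagonal (fun s => ph (q := q) (M := M) T k (compPerm i0 T x q s))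

/-- Several rounds. -/
noncomputable def rnds (i0 : Fin n) (T : (Fin r → Bool) → DTree n) (x : Fin n → Bool) :
    ℕ → Matrix (Bs n r q M) (Bs n r q M) ℂ
  | 0 => 1
  | k + 1 => rnd i0 T k x * rnds i0 T x k

lemma impl_rnds (i0 : Fin n) (T : (Fin r → Bool) → DTree n) (k : ℕ) :
    Impl (2 * q * k) (fun x => rnds (q := q) (M := M) i0 T x k) := by
  induction k with
  | zero => exact Impl.unit _ (one_mem _)
  | succ k ih =>
    have := Impl.mul (Impl.mul (Impl.unit _ (Rm_unitary (n := n) (r := r) (q := q) (M := M) k))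
      (impl_phase (q := q) (M := M) i0 T k)) ih
    exact this.congr' (by ring) (fun x => rfl)

end circuit

/-! ### Grover analysis -/
section grover
variable {P : Type*} [Fintype P]

/-- The Grover iterate. -/
noncomputable def gr (f : P → Bool) (v : P → ℝ) : P → ℝ :=
  fun ρ => 2 * ((1 / (Fintype.card P : ℝ)) * ∑ ρ', (if f ρ' then 1 else -1) * v ρ')
    - (if f ρ then 1 else -1) * v ρ

lemma gr_sub (f : P → Bool) (v w : P → ℝ) : gr f (v - w) = gr f v - gr f w := by
  ext ρ
  simp only [gr, Pi.sub_apply, mul_sub, Finset.sum_sub_distrib]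
  ring

lemma gr_norm [Nonempty P] (f : P → Bool) (v : P → ℝ) : ∑ ρ, gr f v ρ ^ 2 = ∑ ρ, v ρ ^ 2 := by
  have hc : (Fintype.card P : ℝ) ≠ 0 := by exact_mod_cast Fintype.card_ne_zero
  simp only [gr, sub_sq]
  rw [Finset.sum_add_distrib, Finset.sum_sub_distrib]
  have h : ∀ ρ, ((if f ρ then (1 : ℝ) else -1) * v ρ) ^ 2 = v ρ ^ 2 := by
    intro ρ; split_ifs <;> ring
  simp only [h]
  rw [← Finset.mul_sum, Finset.sum_const, Finset.card_univ, nsmul_eq_mul]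
  field_simp
  ring

lemma gr_one [Nonempty P] (f : P → Bool) (hf : ∀ ρ, f ρ = true) (j : ℕ) :
    (gr f)^[j] (fun _ => 1) = fun _ => 1 := by
  have hc : (Fintype.card P : ℝ) ≠ 0 := by exact_mod_cast Fintype.card_ne_zero
  apply Function.iterate_fixed
  ext ρ
  simp [gr, hf, hc]
  norm_num

lemma gr_bound [Nonempty P] (f : P → Bool) (γ : ℝ) (hγ : 0 < γ)
    (h : γ * Fintype.card P ≤ ((Finset.univ.filter (fun ρ => f ρ = false)).card : ℝ)) (M : ℕ) :
    (∑ j ∈ Finset.range M, ∑ ρ, (gr f)^[j] (fun _ => 1) ρ) ^ 2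
      ≤ (Fintype.card P : ℝ) ^ 2 / γ := by
  have hc : (0 : ℝ) < Fintype.card P := by exact_mod_cast Fintype.card_pos
  set R : ℝ := (Fintype.card P : ℝ) with hR
  set K : ℝ := ((Finset.univ.filter (fun ρ => f ρ = false)).card : ℝ) with hK
  have hKpos : 0 < K := lt_of_lt_of_le (by positivity) h
  set w : P → ℝ := fun ρ => if f ρ then 0 else -(R / (2 * K)) with hw
  have hfil : ∀ c : ℝ, ∑ ρ, (if f ρ then 0 else c) = K * c := by
    intro c
    have : ∀ ρ, (if f ρ then (0:ℝ) else c) = if f ρ = false then c else 0 := by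
      intro ρ; cases f ρ <;> simp
    simp only [this]
    rw [← Finset.sum_filter, Finset.sum_const, nsmul_eq_mul]
  have hgw : gr f w - w = fun _ => 1 := by
    ext ρ
    have h1 : ∀ ρ', (if f ρ' then (1:ℝ) else -1) * w ρ' = if f ρ' then 0 else R / (2 * K) := by
      intro ρ'; simp only [hw]; split_ifs <;> simp
    simp only [gr, Pi.sub_apply, h1, hfil]
    simp only [hw]
    rw [← hR]
    split_ifs <;> field_simp <;> ring
  have hit : ∀ j, (gr f)^[j] (fun _ => 1) = (gr f)^[j + 1] w - (gr f)^[j] w := by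
    intro j
    induction j with
    | zero => simp [hgw]
    | succ j ih =>
      rw [Function.iterate_succ_apply', ih, gr_sub, ← Function.iterate_succ_apply' (gr f),
        ← Function.iterate_succ_apply' (gr f)]
  have hsum : ∑ j ∈ Finset.range M, ∑ ρ, (gr f)^[j] (fun _ => 1) ρ
      = ∑ ρ, ((gr f)^[M] w ρ - w ρ) := by
    rw [Finset.sum_comm]
    refine Finset.sum_congr rfl fun ρ _ => ?_
    simp only [hit, Pi.sub_apply]
    rw [Finset.sum_range_sub (fun j => (gr f)^[j] w ρ)]
    rfl
  have hnorm : ∀ j, ∑ ρ, (gr f)^[j] w ρ ^ 2 = ∑ ρ, w ρ ^ 2 := by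
    intro j
    induction j with
    | zero => rfl
    | succ j ih => rw [Function.iterate_succ_apply', gr_norm, ih]
  have hw2 : ∑ ρ, w ρ ^ 2 = R ^ 2 / (4 * K) := by
    have : ∀ ρ, w ρ ^ 2 = if f ρ then 0 else (R / (2 * K)) ^ 2 := by
      intro ρ; simp only [hw]; split_ifs <;> ring
    simp only [this, hfil]
    field_simp
    ring
  rw [hsum]
  calc (∑ ρ, ((gr f)^[M] w ρ - w ρ)) ^ 2
      ≤ R * ∑ ρ, ((gr f)^[M] w ρ - w ρ) ^ 2 := by
        have := sq_sum_le_card_mul_sum_sq (s := Finset.univ) (f := fun ρ => (gr f)^[M] w ρ - w ρ)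
        simpa [hR] using this
    _ ≤ R * ∑ ρ, (2 * (gr f)^[M] w ρ ^ 2 + 2 * w ρ ^ 2) := by
        gcongr with ρ
        nlinarith [sq_nonneg ((gr f)^[M] w ρ + w ρ)]
    _ = R * (R ^ 2 / K) := by
        rw [Finset.sum_add_distrib, ← Finset.mul_sum, ← Finset.mul_sum, hnorm, hw2]
        field_simp
        ring
    _ ≤ R ^ 2 / γ := by
        rw [mul_div_assoc', div_le_div_iff₀ hKpos hγ]
        nlinarith [sq_nonneg R, mul_le_mul_of_nonneg_left h (sq_nonneg R)]

end grover

section final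
variable {n r q M : ℕ}

/-- State with amplitude `g j ρ` on clean registers. -/
noncomputable def st (i0 : Fin n) (g : ℕ → (Fin r → Bool) → ℝ) : Bs n r q M → ℂ :=
  fun s => if s.1 = i0 ∧ s.2.1 = false ∧ s.2.2.2.1 = (fun _ => false)
    then (g s.2.2.2.2 s.2.2.1 : ℂ) else 0

lemma rnd_st (i0 : Fin n) (T : (Fin r → Bool) → DTree n) (hT : ∀ ρ, (T ρ).depth ≤ q)
    (x : Fin n → Bool) (k : ℕ) (g : ℕ → (Fin r → Bool) → ℝ) :
    (rnd (q := q) (M := M) i0 T k x).mulVec (st i0 g) =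
      st i0 (fun j => if k < j then gr (fun ρ => (T ρ).eval x) (g j) else g j) := by
  have hph : (Matrix.diagonal (fun s => ph (q := q) (M := M) T k (compPerm i0 T x q s))).mulVec
      (st i0 g) = st i0 (fun j ρ => if k < j then
        (if (T ρ).eval x then 1 else -1) * g j ρ else g j ρ) := by
    ext ⟨i, b, ρ, h, j⟩
    rw [Matrix.mulVec_diagonal]
    by_cases hc : i = i0 ∧ b = false ∧ h = (fun _ => false)
    · obtain ⟨rfl, rfl, rfl⟩ := hc
      obtain ⟨h, h1, h2, h3, h4⟩ := comp_spec i T hT x ρ j q le_rfl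
      rw [h1]
      have := leafVal_eq (cur T ρ h q) (by omega) x
      rw [h3] at this
      simp only [st, ph, this, and_self, if_true]
      split_ifs <;> simp
    · simp only [st, if_neg hc, mul_zero]
  rw [rnd, ← Matrix.mulVec_mulVec, hph, Rm, Matrix.sub_mulVec, Matrix.smul_mulVec,
    Matrix.sub_mulVec, Matrix.one_mulVec]
  ext ⟨i, b, ρ, h, j⟩
  simp only [Pi.sub_apply, Pi.smul_apply, Jm_mulVec, Dm, Matrix.mulVec_diagonal]
  by_cases hc : i = i0 ∧ b = false ∧ h = (fun _ => false)
  · simp only [st, if_pos hc]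
    by_cases hk : k < (j : ℕ)
    · simp only [hk, if_true, gr, smul_eq_mul]
      push_cast
      simp
      ring
    · simp [hk]
  · simp [st, if_neg hc]

lemma rnds_st (i0 : Fin n) (T : (Fin r → Bool) → DTree n) (hT : ∀ ρ, (T ρ).depth ≤ q)
    (x : Fin n → Bool) (k : ℕ) :
    (rnds (q := q) (M := M) i0 T x k).mulVec (st i0 (fun _ _ => 1)) =
      st i0 (fun j => (gr (fun ρ => (T ρ).eval x))^[min j k] (fun _ => 1)) := by
  induction k with
  | zero => simp [rnds]
  | succ k ih =>
    rw [rnds, ← Matrix.mulVec_mulVec, ih, rnd_st _ _ hT]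
    congr 1
    ext j : 1
    split_ifs with h
    · rw [← Function.iterate_succ_apply' (gr _), min_eq_right (by omega), min_eq_right (by omega)]
    · rw [min_eq_left (by omega), min_eq_left (by omega)]

lemma sum_st (i0 : Fin n) (g : ℕ → (Fin r → Bool) → ℝ) :
    ∑ s : Bs n r q M, st i0 g s = ((∑ j ∈ Finset.range M, ∑ ρ, g j ρ : ℝ) : ℂ) := by
  rw [Fintype.sum_prod_type, Finset.sum_eq_single i0]
  · rw [Fintype.sum_prod_type, Finset.sum_eq_single false]
    · rw [Fintype.sum_prod_type, Finset.sum_comm, Finset.sum_range]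
      push_cast
      rw [Finset.sum_comm]
      conv_rhs => rw [Finset.sum_comm]
      refine Finset.sum_congr rfl fun ρ _ => ?_
      rw [Fintype.sum_prod_type, Finset.sum_eq_single (fun _ => false)]
      · simp [st]
      · intro c _ hc; simp [st, hc]
      · simp
    · intro c _ hc; simp only [st, hc]; simp
    · simp
  · intro c _ hc; simp only [st, hc]; simp
  · simp

/-- Main existence lemma. -/
lemma exists_alg (i0 : Fin n) (hM : 0 < M) (T : (Fin r → Bool) → DTree n)
    (hT : ∀ ρ, (T ρ).depth ≤ q) :
    ∃ (F : (Fin n → Bool) → Matrix (Bs n r q M) (Bs n r q M) ℂ) (init : Bs n r q M),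
      Impl (2 * q * M) F ∧ ∀ x, F x init init =
        (((∑ j ∈ Finset.range M, ∑ ρ, (gr (fun ρ => (T ρ).eval x))^[j] (fun _ => 1) ρ)
          / (M * 2 ^ r) : ℝ) : ℂ) := by
  have hMR : (0 : ℝ) < M * 2 ^ r := by positivity
  set c : ℝ := (Real.sqrt (M * 2 ^ r))⁻¹ with hcdef
  have hc : c * c = 1 / (M * 2 ^ r) := by
    rw [hcdef, ← mul_inv, Real.mul_self_sqrt hMR.le, one_div]
  let init : Bs n r q M := (i0, false, fun _ => false, fun _ => false, ⟨0, hM⟩)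
  let Φ : Bs n r q M → ℂ := fun s => c * st i0 (fun _ _ => 1) s
  have hΦ : ∑ s, Complex.normSq (Φ s) = 1 := by
    have h1 : ∀ s, ((Complex.normSq (Φ s) : ℝ) : ℂ)
        = ((c * c : ℝ) : ℂ) * st i0 (fun _ _ => 1) s := by
      intro s
      simp only [Φ, st]
      split_ifs <;> simp [Complex.normSq_ofReal]
    apply Complex.ofReal_injective
    rw [Complex.ofReal_sum]
    simp only [h1]
    rw [← Finset.mul_sum, sum_st, ← Complex.ofReal_mul, hc]
    congr 1
    simp
    field_simp
  obtain ⟨V, hV, hVi⟩ := exists_unitary Φ init hΦ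
  refine ⟨fun x => star V * (rnds i0 T x M * V), init, ?_, ?_⟩
  · have := Impl.mul (Impl.unit (star V) (Unitary.star_mem hV)) (Impl.mul (impl_rnds (q := q) (M := M) i0 T M)
      (Impl.unit V hV))
    exact this.congr' (by omega) (fun x => rfl)
  · intro x
    have h1 : ∀ s, (rnds (q := q) (M := M) i0 T x M * V) s init
        = c * st i0 (fun j => (gr (fun ρ => (T ρ).eval x))^[min j M] (fun _ => 1)) s := by
      intro s
      rw [← rnds_st i0 T hT]
      simp only [Matrix.mul_apply, hVi, Φ, Matrix.mulVec, dotProduct, Finset.mul_sum]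
      refine Finset.sum_congr rfl fun t _ => ?_
      ring
    change (star V * (rnds i0 T x M * V) : Matrix (Bs n r q M) (Bs n r q M) ℂ) init init = _
    rw [Matrix.mul_apply]
    simp only [h1, Matrix.star_apply, hVi, Φ]
    have h2 : ∀ s : Bs n r q M, star ((c : ℂ) * st i0 (fun _ _ => 1) s) *
        (c * st i0 (fun j => (gr (fun ρ => (T ρ).eval x))^[min j M] (fun _ => 1)) s)
        = ((c * c : ℝ) : ℂ) *
          st i0 (fun j => (gr (fun ρ => (T ρ).eval x))^[min j M] (fun _ => 1)) s := by
      intro s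
      simp only [st]
      split_ifs <;> simp
      ring
    simp only [h2]
    rw [← Finset.mul_sum, sum_st, ← Complex.ofReal_mul, hc, one_div_mul_eq_div]
    congr 2
    refine Finset.sum_congr rfl fun j hj => ?_
    rw [min_eq_left (Finset.mem_range.1 hj).le]

end final

end AmpAmp

/-- **Amplitude amplification for promise problems in the query model.**
There is a universal constant `Cst` such that: whenever a classical randomized
algorithm (a depth-`q` decision tree `T ρ` for each random string
`ρ ∈ {0,1}ʳ`) always accepts inputs in `Y` and rejects inputs in the disjoint
set `N` with probability at least `γ > 0`, there is a quantum query algorithm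
making `q' = O(q/√γ)` queries to the oracle `U_x` that always accepts `x ∈ Y`
and rejects `x ∈ N` with probability at least `2/3`. -/
theorem stmt15 : ∃ Cst : ℝ, 0 < Cst ∧
    ∀ (n r q : ℕ), 0 < n →
    ∀ (Y N : Set (Fin n → Bool)), Disjoint Y N →
    ∀ (γ : ℝ), 0 < γ →
    ∀ T : (Fin r → Bool) → DTree n,
      (∀ ρ, (T ρ).depth ≤ q) →
      (∀ x ∈ Y, ∀ ρ, (T ρ).eval x = true) →
      (∀ x ∈ N, γ * 2 ^ r ≤
        ((Finset.univ.filter (fun ρ : Fin r → Bool => (T ρ).eval x = false)).card : ℝ)) →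
    ∃ (m q' : ℕ)
      (Vs : ℕ → Matrix (Fin n × Bool × Fin (m + 1)) (Fin n × Bool × Fin (m + 1)) ℂ)
      (Acc : Finset (Fin n × Bool × Fin (m + 1)))
      (init : Fin n × Bool × Fin (m + 1)),
      (q' : ℝ) ≤ Cst * q / Real.sqrt γ ∧
      (∀ t, Vs t ∈ Matrix.unitaryGroup (Fin n × Bool × Fin (m + 1)) ℂ) ∧
      (∀ x ∈ Y, acceptProb n (m + 1) x Vs q' Acc init = 1) ∧
      (∀ x ∈ N, acceptProb n (m + 1) x Vs q' Acc init ≤ 1 / 3) := by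
  refine ⟨6, by norm_num, ?_⟩
  intro n r q hn Y N hYN γ hγ T hT hY hN
  by_cases hNe : N = ∅
  · refine ⟨0, 0, fun _ => 1, Finset.univ, (⟨0, hn⟩, false, 0), ?_, fun _ => one_mem _, ?_, ?_⟩
    · simp only [Nat.cast_zero]; positivity
    · intro x _
      simp only [acceptProb, chain, Matrix.one_apply]
      rw [Finset.sum_eq_single (⟨0, hn⟩, false, 0)]
      · simp
      · intro b _ hb; simp [hb]
      · simp
    · simp [hNe]
  obtain ⟨x0, hx0⟩ := Set.nonempty_iff_ne_empty.2 hNe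
  have hγ1 : γ ≤ 1 := by
    have h1 := hN x0 hx0
    have h2 : ((Finset.univ.filter (fun ρ : Fin r → Bool => (T ρ).eval x0 = false)).card : ℝ)
        ≤ 2 ^ r := by
      have := Finset.card_le_univ
        (Finset.univ.filter (fun ρ : Fin r → Bool => (T ρ).eval x0 = false))
      simp only [Fintype.card_pi, Fintype.card_bool, Finset.prod_const, Finset.card_univ,
        Fintype.card_fin] at this
      exact_mod_cast this
    have h3 : (0 : ℝ) < 2 ^ r := by positivity
    nlinarith
  have hs : 0 < Real.sqrt γ := Real.sqrt_pos.2 hγ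
  have hs1 : Real.sqrt γ ≤ 1 := Real.sqrt_le_one.2 hγ1
  have hss : Real.sqrt γ * Real.sqrt γ = γ := Real.mul_self_sqrt hγ.le
  set M : ℕ := ⌈2 / Real.sqrt γ⌉₊ with hMdef
  have hM1 : 2 / Real.sqrt γ ≤ M := Nat.le_ceil _
  have hM0 : 0 < M := Nat.ceil_pos.2 (by positivity)
  have hM2 : (M : ℝ) ≤ 3 / Real.sqrt γ := by
    have h1 := (Nat.ceil_lt_add_one (a := 2 / Real.sqrt γ) (by positivity)).le
    have h2 : 1 ≤ 1 / Real.sqrt γ := by rw [le_div_iff₀ hs]; linarith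
    calc (M : ℝ) ≤ 2 / Real.sqrt γ + 1 := h1
      _ ≤ 2 / Real.sqrt γ + 1 / Real.sqrt γ := by linarith
      _ = 3 / Real.sqrt γ := by ring
  have hMγ : 3 ≤ (M : ℝ) ^ 2 * γ := by
    rw [div_le_iff₀ hs] at hM1
    have : (M : ℝ) ^ 2 * γ = (M * Real.sqrt γ) ^ 2 := by rw [mul_pow, Real.sq_sqrt hγ.le]
    rw [this]; nlinarith
  obtain ⟨F, init, hF, hFx⟩ := AmpAmp.exists_alg (q := q) (⟨0, hn⟩ : Fin n) hM0 T hT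
  obtain ⟨m, hm⟩ : ∃ m, Fintype.card (AmpAmp.Wk r q M) = m + 1 :=
    Nat.exists_eq_succ_of_ne_zero (@Fintype.card_ne_zero _ _ ⟨init.2.2⟩)
  have e : AmpAmp.Wk r q M ≃ Fin (m + 1) := Fintype.equivFinOfCardEq hm
  obtain ⟨Vs, hVs, hch⟩ := hF.toChain e
  have hacc : ∀ x, acceptProb n (m + 1) x Vs (2 * q * M)
      {(AmpAmp.basisEquiv n e).symm init} ((AmpAmp.basisEquiv n e).symm init) =
      ((∑ j ∈ Finset.range M, ∑ ρ, (AmpAmp.gr (fun ρ => (T ρ).eval x))^[j] (fun _ => 1) ρ)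
          / (M * 2 ^ r)) ^ 2 := by
    intro x
    rw [acceptProb, Finset.sum_singleton, hch, Matrix.submatrix_apply, Equiv.apply_symm_apply,
      hFx, Complex.normSq_ofReal, sq]
  have hMpos : (0 : ℝ) < M := by exact_mod_cast hM0
  refine ⟨m, 2 * q * M, Vs, {(AmpAmp.basisEquiv n e).symm init},
    (AmpAmp.basisEquiv n e).symm init, ?_, hVs, ?_, ?_⟩
  · push_cast
    calc (2 * q * M : ℝ) ≤ 2 * q * (3 / Real.sqrt γ) := by gcongr
      _ = 6 * q / Real.sqrt γ := by ring
  · intro x hx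
    rw [hacc]
    simp only [AmpAmp.gr_one (fun ρ => (T ρ).eval x) (hY x hx)]
    have hMne : (M : ℝ) ≠ 0 := hMpos.ne'
    simp [hMne]
  · intro x hx
    rw [hacc]
    have hb := AmpAmp.gr_bound (fun ρ => (T ρ).eval x) γ hγ (by simpa using hN x hx) M
    have hcard : (Fintype.card (Fin r → Bool) : ℝ) = 2 ^ r := by simp
    rw [hcard] at hb
    rw [div_pow, div_le_iff₀ (by positivity)]
    refine hb.trans ?_
    rw [div_le_iff₀ hγ]
    have h3 : (0 : ℝ) ≤ (2 ^ r) ^ 2 := by positivity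
    nlinarith [mul_le_mul_of_nonneg_right hMγ h3]
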